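/- In the quantization setting, let A be a nonempty set, K₂ > 0, and p a Markov kernel from X × A to X with ‖p(·|x,a) − p(·|y,a)‖_TV ≤ K₂·d(x,y) for all a ∈ A and x, y ∈ X. Define p_q(·|x_i,a) = ∫_{S_i} (T⋆p(·|z,a)) ν_i(dz) for each grid point x_i. Then for all indices i, j and all a ∈ A: ‖p_q(·|x_i,a) − p_q(·|x_j,a)‖_TV ≤ 2K₂/n + K₂·d(x_i,x_j). -/

import Mathlib

open Filter Topology MeasureTheory ProbabilityTheory

/-- Total variation distance `‖μ − ν‖_TV = 2·sup_{Borel B} |μ(B) − ν(B)|`. -/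
noncomputable def tvDist {X : Type*} [MeasurableSpace X]
    (μ ν : Measure X) : ℝ :=
  2 * ⨆ B : {s : Set X // MeasurableSet s}, |(μ ↑B).toReal - (ν ↑B).toReal|

theorem two_mul_abs_sub_le_tvDist {X : Type*} [MeasurableSpace X] (μ ν : Measure X)
    [IsProbabilityMeasure μ] [IsProbabilityMeasure ν] {B : Set X} (hB : MeasurableSet B) :
    2 * |μ.real B - ν.real B| ≤ tvDist μ ν := by
  have hbdd : BddAbove (Set.range fun B : {s : Set X // MeasurableSet s} =>
      |(μ ↑B).toReal - (ν ↑B).toReal|) := by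
    refine ⟨1, ?_⟩
    rintro _ ⟨B, rfl⟩
    exact abs_sub_le_of_nonneg_of_le measureReal_nonneg measureReal_le_one
      measureReal_nonneg measureReal_le_one
  exact mul_le_mul_of_nonneg_left (le_ciSup hbdd ⟨B, hB⟩) zero_le_two

theorem tvDist_le_of_forall_abs_sub_le {X : Type*} [MeasurableSpace X] {μ ν : Measure X} {c : ℝ}
    (h : ∀ B, MeasurableSet B → 2 * |μ.real B - ν.real B| ≤ c) : tvDist μ ν ≤ c := by
  have : Nonempty {s : Set X // MeasurableSet s} := ⟨⟨∅, MeasurableSet.empty⟩⟩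
  have hsup : (⨆ B : {s : Set X // MeasurableSet s}, |(μ ↑B).toReal - (ν ↑B).toReal|) ≤ c / 2 := by
    refine ciSup_le fun B => ?_
    have := h B B.2
    simp only [measureReal_def] at this
    linarith
  unfold tvDist
  linarith

/-- Total variation distance does not increase under pushforwards. -/
theorem tvDist_map_le {X Y : Type*} [MeasurableSpace X] [MeasurableSpace Y] (μ ν : Measure X)
    [IsProbabilityMeasure μ] [IsProbabilityMeasure ν] {f : X → Y} (hf : Measurable f) :
    tvDist (μ.map f) (ν.map f) ≤ tvDist μ ν := by
  refine tvDist_le_of_forall_abs_sub_le fun B hB => ?_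
  rw [map_measureReal_apply hf hB, map_measureReal_apply hf hB]
  exact two_mul_abs_sub_le_tvDist μ ν (hf hB)

theorem integral_sub_integral_le_of_ae_ae_sub_le {X : Type*} [MeasurableSpace X] {μ ν : Measure X}
    [IsProbabilityMeasure μ] [IsProbabilityMeasure ν] {g : X → ℝ} {c : ℝ}
    (hμ : Integrable g μ) (hν : Integrable g ν) (h : ∀ᵐ z ∂μ, ∀ᵐ w ∂ν, g z - g w ≤ c) :
    ∫ z, g z ∂μ - ∫ w, g w ∂ν ≤ c := by
  have hz : ∀ᵐ z ∂μ, g z ≤ c + ∫ w, g w ∂ν := by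
    filter_upwards [h] with z hz
    have := integral_mono_ae ((integrable_const (g z)).sub hν) (integrable_const c) hz
    simp only [Pi.sub_apply] at this
    rw [integral_sub (integrable_const _) hν] at this
    simp only [integral_const, probReal_univ, one_smul] at this
    linarith
  have := integral_mono_ae hμ (integrable_const (c + ∫ w, g w ∂ν)) hz
  simp only [integral_const, probReal_univ, one_smul] at this
  linarith

/-- Mixtures of two families of probability measures are as close in total variation as the
members of the families are. -/
theorem tvDist_bind_le {X Y : Type*} [MeasurableSpace X] [MeasurableSpace Y] {μ ν : Measure X}
    [IsProbabilityMeasure μ] [IsProbabilityMeasure ν] (κ : Kernel X Y) [IsMarkovKernel κ] {c : ℝ}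
    {S S' : Set X} (hS : ∀ᵐ z ∂μ, z ∈ S) (hS' : ∀ᵐ w ∂ν, w ∈ S')
    (h : ∀ z ∈ S, ∀ w ∈ S', tvDist (κ z) (κ w) ≤ c) :
    tvDist (μ.bind κ) (ν.bind κ) ≤ c := by
  refine tvDist_le_of_forall_abs_sub_le fun B hB => ?_
  have hmeas : Measurable fun z => (κ z).real B := (κ.measurable_coe hB).ennreal_toReal
  have hint (ρ : Measure X) [IsProbabilityMeasure ρ] : Integrable (fun z => (κ z).real B) ρ :=
    Integrable.of_bound hmeas.aestronglyMeasurable 1 (ae_of_all _ fun z => by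
      rw [Real.norm_of_nonneg measureReal_nonneg]; exact measureReal_le_one)
  have hbind (ρ : Measure X) : (ρ.bind κ).real B = ∫ z, (κ z).real B ∂ρ := by
    rw [measureReal_def, Measure.bind_apply hB κ.aemeasurable]
    exact (integral_toReal (κ.measurable_coe hB).aemeasurable
      (ae_of_all _ fun z => measure_lt_top _ _)).symm
  have hκ : ∀ z ∈ S, ∀ w ∈ S', |(κ z).real B - (κ w).real B| ≤ c / 2 := fun z hz w hw => by
    linarith [two_mul_abs_sub_le_tvDist (κ z) (κ w) hB, h z hz w hw]
  have h₁ := integral_sub_integral_le_of_ae_ae_sub_le (c := c / 2) (hint μ) (hint ν) (by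
    filter_upwards [hS] with z hz
    filter_upwards [hS'] with w hw using (abs_le.mp (hκ z hz w hw)).2)
  have h₂ := integral_sub_integral_le_of_ae_ae_sub_le (c := c / 2) (hint ν) (hint μ) (by
    filter_upwards [hS'] with w hw
    filter_upwards [hS] with z hz
    linarith [(abs_le.mp (hκ z hz w hw)).1])
  rw [hbind, hbind]
  have : |∫ z, (κ z).real B ∂μ - ∫ z, (κ z).real B ∂ν| ≤ c / 2 :=
    abs_le.mpr ⟨by linarith, h₁⟩
  linarith

/-- In the quantization setting, if
`‖p(·|x,a) − p(·|y,a)‖_TV ≤ K₂·d(x,y)`, then the quantized kernel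
`p_q(·|x_i,a) = ∫_{S_i} T⋆p(·|z,a) ν_i(dz)` satisfies, for any two grid points
(i.e. points of the form `T x`, `T y`),
`‖p_q(·|x_i,a) − p_q(·|x_j,a)‖_TV ≤ 2K₂/n + K₂·d(x_i,x_j)`. -/
theorem statement14 {X A : Type*} [MetricSpace X] [CompactSpace X]
    [MeasurableSpace X] [BorelSpace X] [MeasurableSpace A] [Nonempty A]
    (n : ℕ) (hn : 1 ≤ n)
    (T : X → X) (hTmeas : Measurable T) (hTfin : (Set.range T).Finite)
    (hTd : ∀ x, dist x (T x) ≤ 1 / (n : ℝ))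
    (ν : X → Measure X)
    (hν : ∀ x, IsProbabilityMeasure (ν (T x)))
    (hνcell : ∀ x, ν (T x) {z | T z = T x} = 1)
    (K₂ : ℝ) (hK₂ : 0 < K₂)
    (p : Kernel (X × A) X) [IsMarkovKernel p]
    (hpLip : ∀ (a : A) (x y : X), tvDist (p (x, a)) (p (y, a)) ≤ K₂ * dist x y) :
    ∀ (x y : X) (a : A),
      tvDist
          (((ν (T x)).restrict {z | T z = T x}).bind fun z => (p (z, a)).map T)
          (((ν (T y)).restrict {z | T z = T y}).bind fun z => (p (z, a)).map T) ≤
        2 * K₂ / (n : ℝ) + K₂ * dist (T x) (T y) := by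
  intro x y a
  have hcell (x : X) : ∀ᵐ z ∂ν (T x), z ∈ {z | T z = T x} :=
    have := hν x
    (prob_compl_eq_zero_iff (hTmeas (measurableSet_singleton (T x)))).mpr (hνcell x)
  have := hν x
  have := hν y
  rw [Measure.restrict_eq_self_of_ae_mem (hcell x), Measure.restrict_eq_self_of_ae_mem (hcell y)]
  let κ : Kernel X X := (p.comap (fun z => (z, a)) measurable_prodMk_right).map T
  have : IsMarkovKernel κ := Kernel.IsMarkovKernel.map _ hTmeas
  have hκ : (fun z => (p (z, a)).map T) = κ := by
    funext z
    rw [Kernel.map_apply _ hTmeas, Kernel.comap_apply]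
  rw [hκ]
  refine tvDist_bind_le κ (hcell x) (hcell y) fun z hz w hw => ?_
  have hz' : dist z (T x) ≤ 1 / (n : ℝ) := hz ▸ hTd z
  have hw' : dist (T y) w ≤ 1 / (n : ℝ) := by rw [dist_comm]; exact hw ▸ hTd w
  calc tvDist (κ z) (κ w) ≤ tvDist (p (z, a)) (p (w, a)) := by
        rw [← hκ]; exact tvDist_map_le _ _ hTmeas
    _ ≤ K₂ * dist z w := hpLip a z w
    _ ≤ K₂ * (1 / n + dist (T x) (T y) + 1 / n) := by
        gcongr
        exact (dist_triangle4 z (T x) (T y) w).trans (by gcongr)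
    _ = 2 * K₂ / n + K₂ * dist (T x) (T y) := by ring
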